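/- Let d ≥ 1 be an integer and let t_1 < t_2 < … < t_{d+2} be real numbers. Define, for each of the two triangulations of C(d+2, d), its GKZ-entry at vertex 1 as the sum of the quantities V_i over those simplices of the triangulation that contain the point μ_d(t_1) as a vertex (i.e., over the omitted indices i ≠ 1 occurring in that triangulation), where V_i := ∏_{1 ≤ k < ℓ ≤ d+2, k ≠ i, ℓ ≠ i} (t_ℓ − t_k). Then the GKZ-entries at vertex 1 of the lower and the upper triangulation differ exactly by V_1 > 0; concretely, ∑_{i even, 1 ≤ i ≤ d+2} V_i = V_1 + ∑_{i odd, 3 ≤ i ≤ d+2} V_i. Consequently, if d is even the GKZ-entry at vertex 1 of the lower triangulation is strictly larger than that of the upper triangulation, and if d is odd it is strictly smaller. (This is the content of the Proposition: for a flip from the lower to the upper triangulation of a circuit, gkz_Δ >_lex gkz_Δ' when d is even and gkz_Δ <_lex gkz_Δ' when d is odd.) -/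

import Mathlib

open Finset

/-- The `d`-th moment curve `t ↦ (t, t², …, t^d)` in `ℝ^d`. -/
noncomputable def moment (d : ℕ) (s : ℝ) : Fin d → ℝ := fun i => s ^ (i.val + 1)

/-- The product of all differences of the points other than `t i` is a Vandermonde determinant. -/
theorem prod_erase_sub_eq_det_vandermonde {R : Type*} [CommRing R] {n : ℕ}
    (t : Fin (n + 1) → R) (i : Fin (n + 1)) :
    ∏ ℓ ∈ univ.erase i, ∏ k ∈ (Iio ℓ).erase i, (t ℓ - t k) =
      (Matrix.vandermonde (t ∘ i.succAbove)).det := by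
  have houter : univ.erase i = univ.map i.succAboveEmb := by
    ext j
    simp [Fin.exists_succAbove_eq_iff]
  have hinner (l : Fin n) :
      (Iio (i.succAbove l)).erase i = (Iio l).map i.succAboveEmb := by
    ext j
    simp only [mem_erase, mem_Iio, mem_map, Fin.coe_succAboveEmb]
    constructor
    · rintro ⟨hj, hlt⟩
      obtain ⟨k, rfl⟩ := Fin.exists_succAbove_eq hj
      exact ⟨k, Fin.succAbove_lt_succAbove_iff.mp hlt, rfl⟩
    · rintro ⟨k, hk, rfl⟩
      exact ⟨i.succAbove_ne k, Fin.succAbove_lt_succAbove_iff.mpr hk⟩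
  rw [Matrix.det_vandermonde, houter, prod_map]
  simp only [Fin.coe_succAboveEmb, hinner, prod_map, Function.comp_apply]
  exact prod_comm' (by simp)

/-- The Vandermonde determinants obtained by omitting one point at a time have vanishing
alternating sum. -/
theorem sum_neg_one_pow_mul_det_vandermonde_succAbove {R : Type*} [CommRing R] {n : ℕ}
    (t : Fin (n + 2) → R) :
    ∑ i : Fin (n + 2), (-1) ^ (i : ℕ) * (Matrix.vandermonde (t ∘ i.succAbove)).det = 0 := by
  let A : Matrix (Fin (n + 2)) (Fin (n + 2)) R :=
    Matrix.of fun i => Fin.cons 1 fun j : Fin (n + 1) => t i ^ (j : ℕ)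
  have hA : A.det = 0 :=
    Matrix.det_zero_of_column_eq (i := 0) (j := 1) (by simp) fun i => by
      rw [← Fin.succ_zero_eq_one]
      simp only [A, Matrix.of_apply, Fin.cons_zero, Fin.cons_succ]
      simp
  rw [Matrix.det_succ_column_zero] at hA
  rw [← hA]
  refine sum_congr rfl fun i _ => ?_
  have hsub : A.submatrix i.succAbove Fin.succ = Matrix.vandermonde (t ∘ i.succAbove) := by
    ext j k
    simp [A, Matrix.vandermonde_apply]
  rw [hsub]
  simp [A]

/-- The GKZ-entries at vertex `1` (the index `0` in `Fin (d+2)`, i.e. `1`-based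
index `1`) of the lower and upper triangulations of `C(d+2, d)` differ exactly
by `V_1 > 0`: concretely `∑_{i even} V_i = V_1 + ∑_{i odd, i ≥ 3} V_i`
(`1`-based indices).  Consequently, for `d` even the entry of the lower
triangulation (which sums `V_i` over the simplices containing vertex `1`,
i.e. over the omitted indices `i ≡ d (mod 2)`, `i ≠ 1`) is strictly larger
than that of the upper triangulation (omitted indices `i ≢ d (mod 2)`,
`i ≠ 1`), and for `d` odd it is strictly smaller. -/
theorem gkz_entry_at_vertex_one (d : ℕ) (hd : 1 ≤ d)
    (t : Fin (d + 2) → ℝ) (ht : StrictMono t) (V : Fin (d + 2) → ℝ)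
    (hV : ∀ i, V i = ∏ ℓ ∈ Finset.univ.erase i, ∏ k ∈ (Finset.Iio ℓ).erase i, (t ℓ - t k))
    (gkzLower gkzUpper : ℝ)
    (hLower : gkzLower = ∑ i ∈ Finset.univ.filter
        (fun i : Fin (d + 2) => (i.val + 1) % 2 = d % 2 ∧ i ≠ 0), V i)
    (hUpper : gkzUpper = ∑ i ∈ Finset.univ.filter
        (fun i : Fin (d + 2) => (i.val + 1) % 2 ≠ d % 2 ∧ i ≠ 0), V i) :
    0 < V 0 ∧
    (∑ i ∈ Finset.univ.filter (fun i : Fin (d + 2) => (i.val + 1) % 2 = 0), V i =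
      V 0 + ∑ i ∈ Finset.univ.filter
        (fun i : Fin (d + 2) => (i.val + 1) % 2 = 1 ∧ 3 ≤ i.val + 1), V i) ∧
    (Even d → gkzUpper < gkzLower) ∧
    (Odd d → gkzLower < gkzUpper) := by
  have hpos : 0 < V 0 := by
    rw [hV]
    refine prod_pos fun ℓ _ => prod_pos fun k hk => sub_pos.mpr (ht ?_)
    exact mem_Iio.mp (mem_of_mem_erase hk)
  have halt : ∑ i : Fin (d + 2), (-1) ^ (i : ℕ) * V i = 0 := by
    simp only [hV, prod_erase_sub_eq_det_vandermonde]
    exact sum_neg_one_pow_mul_det_vandermonde_succAbove t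
  have hodd : ∑ i ∈ univ.filter (fun i : Fin (d + 2) => ¬ (i.val + 1) % 2 = 0), V i =
      V 0 + ∑ i ∈ univ.filter
        (fun i : Fin (d + 2) => (i.val + 1) % 2 = 1 ∧ 3 ≤ i.val + 1), V i := by
    rw [← add_sum_erase _ _ (a := (0 : Fin (d + 2))) (by simp)]
    congr 2
    ext i
    simp only [mem_erase, mem_filter, mem_univ, true_and, ne_eq, Fin.ext_iff, Fin.val_zero]
    omega
  have hmain : ∑ i ∈ univ.filter (fun i : Fin (d + 2) => (i.val + 1) % 2 = 0), V i =
      V 0 + ∑ i ∈ univ.filter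
        (fun i : Fin (d + 2) => (i.val + 1) % 2 = 1 ∧ 3 ≤ i.val + 1), V i := by
    rw [← hodd]
    rw [← sum_filter_add_sum_filter_not _ (fun i : Fin (d + 2) => (i.val + 1) % 2 = 0)] at halt
    have heven_sign : ∑ i ∈ univ.filter (fun i : Fin (d + 2) => (i.val + 1) % 2 = 0),
        (-1) ^ (i : ℕ) * V i =
        -∑ i ∈ univ.filter (fun i : Fin (d + 2) => (i.val + 1) % 2 = 0), V i := by
      rw [← sum_neg_distrib]
      refine sum_congr rfl fun i hi => ?_
      have h : Odd (i : ℕ) := Nat.odd_iff.mpr (by have := (mem_filter.mp hi).2; omega)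
      rw [h.neg_one_pow, neg_one_mul]
    have hodd_sign : ∑ i ∈ univ.filter (fun i : Fin (d + 2) => ¬ (i.val + 1) % 2 = 0),
        (-1) ^ (i : ℕ) * V i =
        ∑ i ∈ univ.filter (fun i : Fin (d + 2) => ¬ (i.val + 1) % 2 = 0), V i := by
      refine sum_congr rfl fun i hi => ?_
      have h : Even (i : ℕ) := Nat.even_iff.mpr (by have := (mem_filter.mp hi).2; omega)
      rw [h.neg_one_pow, one_mul]
    rw [heven_sign, hodd_sign] at halt
    linarith
  refine ⟨hpos, hmain, fun hd' => ?_, fun hd' => ?_⟩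
  · rw [Nat.even_iff] at hd'
    have hL : gkzLower =
        ∑ i ∈ univ.filter (fun i : Fin (d + 2) => (i.val + 1) % 2 = 0), V i := by
      rw [hLower]
      refine sum_congr (filter_congr fun i _ => ?_) fun _ _ => rfl
      simp only [ne_eq, Fin.ext_iff, Fin.val_zero]
      omega
    have hU : gkzUpper = ∑ i ∈ univ.filter
        (fun i : Fin (d + 2) => (i.val + 1) % 2 = 1 ∧ 3 ≤ i.val + 1), V i := by
      rw [hUpper]
      refine sum_congr (filter_congr fun i _ => ?_) fun _ _ => rfl
      simp only [ne_eq, Fin.ext_iff, Fin.val_zero]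
      omega
    linarith
  · rw [Nat.odd_iff] at hd'
    have hU : gkzUpper =
        ∑ i ∈ univ.filter (fun i : Fin (d + 2) => (i.val + 1) % 2 = 0), V i := by
      rw [hUpper]
      refine sum_congr (filter_congr fun i _ => ?_) fun _ _ => rfl
      simp only [ne_eq, Fin.ext_iff, Fin.val_zero]
      omega
    have hL : gkzLower = ∑ i ∈ univ.filter
        (fun i : Fin (d + 2) => (i.val + 1) % 2 = 1 ∧ 3 ≤ i.val + 1), V i := by
      rw [hLower]
      refine sum_congr (filter_congr fun i _ => ?_) fun _ _ => rfl
      simp only [ne_eq, Fin.ext_iff, Fin.val_zero]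
      omega
    linarith
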